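/- The family of curves F built from a solution k of the curvature evolution equation moves by curvature up to a tangential term: for all (θ,t) ∈ ℝ × [0,T₀), ∂F/∂t(θ,t) = −k(θ,t)·p(θ,t) − a(θ,t)²·k'(θ,t)·q(θ,t). -/

import Mathlib

open Real Set

noncomputable def wedge (x y : ℝ × ℝ) : ℝ := x.1 * y.2 - x.2 * y.1

noncomputable def er (θ : ℝ) : ℝ × ℝ := (Real.cos θ, Real.sin θ)

noncomputable def etheta (θ : ℝ) : ℝ × ℝ := (-Real.sin θ, Real.cos θ)

/-- partial derivative in the first (spatial) variable -/
noncomputable def pd (f : ℝ → ℝ → ℝ) (θ t : ℝ) : ℝ := deriv (fun x => f x t) θ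

/-- partial derivative in the second (time) variable -/
noncomputable def pt (f : ℝ → ℝ → ℝ) (θ t : ℝ) : ℝ := deriv (fun s => f θ s) t

/-- partial derivative in the first variable, vector valued -/
noncomputable def pdv (f : ℝ → ℝ → ℝ × ℝ) (θ t : ℝ) : ℝ × ℝ := deriv (fun x => f x t) θ

/-- partial derivative in the second variable, vector valued -/
noncomputable def ptv (f : ℝ → ℝ → ℝ × ℝ) (θ t : ℝ) : ℝ × ℝ := deriv (fun s => f θ s) t

/-- Differentiation under the integral sign for an integrand that is `C¹` in the parameter
near the segment of integration. -/
theorem hasDerivAt_intervalIntegral_of_continuousOn {f f' : ℝ → ℝ → ℝ} {U : Set (ℝ × ℝ)}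
    {b c t : ℝ} (hU : IsOpen U) (hbc : uIcc b c ×ˢ {t} ⊆ U)
    (hf : ContinuousOn (Function.uncurry f) U) (hf' : ContinuousOn (Function.uncurry f') U)
    (hderiv : ∀ σ s, (σ, s) ∈ U → HasDerivAt (f σ) (f' σ s) s) :
    HasDerivAt (fun s => ∫ σ in b..c, f σ s) (∫ σ in b..c, f' σ t) t := by
  obtain ⟨V, W, -, hW, hV, htW, hVW⟩ :=
    generalized_tube_lemma isCompact_uIcc isCompact_singleton hU hbc
  obtain ⟨ε, hε, hball⟩ := Metric.nhds_basis_closedBall.mem_iff.1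
    (hW.mem_nhds (htW (mem_singleton t)))
  have hK : uIcc b c ×ˢ Metric.closedBall t ε ⊆ U := (prod_mono hV hball).trans hVW
  obtain ⟨C, hC⟩ := (isCompact_uIcc.prod (isCompact_closedBall t ε)).exists_bound_of_continuousOn
    (hf'.mono hK)
  have hslice : ∀ {g : ℝ → ℝ → ℝ}, ContinuousOn (Function.uncurry g) U →
      ∀ s ∈ Metric.closedBall t ε, ContinuousOn (fun σ => g σ s) (uIcc b c) := by
    intro g hg s hs
    exact hg.comp (f := fun σ => (σ, s)) (by fun_prop) fun σ hσ => hK ⟨hσ, hs⟩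
  have hmeas : ∀ {g : ℝ → ℝ → ℝ}, ContinuousOn (Function.uncurry g) U →
      ∀ s ∈ Metric.closedBall t ε, MeasureTheory.AEStronglyMeasurable (fun σ => g σ s)
        (MeasureTheory.volume.restrict (uIoc b c)) := fun hg s hs =>
    ((hslice hg s hs).mono uIoc_subset_uIcc).aestronglyMeasurable measurableSet_uIoc
  have hnhds := Metric.closedBall_mem_nhds t hε
  have ht := Metric.mem_closedBall_self (x := t) hε.le
  refine (intervalIntegral.hasDerivAt_integral_of_dominated_loc_of_deriv_le
    (F := fun s σ => f σ s) (F' := fun s σ => f' σ s) (bound := fun _ => C) hnhds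
    ?_ (hslice hf t ht).intervalIntegrable (hmeas hf' t ht) ?_ intervalIntegrable_const ?_).2
  · filter_upwards [hnhds] with s hs using hmeas hf s hs
  · exact .of_forall fun σ hσ s hs => hC (σ, s) ⟨uIoc_subset_uIcc hσ, hs⟩
  · exact .of_forall fun σ hσ s hs => hderiv σ s (hK ⟨uIoc_subset_uIcc hσ, hs⟩)

theorem hasDerivAt_fst_of_contDiff {f : ℝ → ℝ → ℝ}
    (hf : ContDiff ℝ (⊤ : ℕ∞) (Function.uncurry f)) (θ t : ℝ) :
    HasDerivAt (fun x => f x t) (fderiv ℝ (Function.uncurry f) (θ, t) (1, 0)) θ :=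
  ((hf.differentiable (by simp)) (θ, t)).hasFDerivAt.comp_hasDerivAt (f := fun x => (x, t)) θ
    ((hasDerivAt_id θ).prodMk (hasDerivAt_const θ t))

theorem hasDerivAt_snd_of_contDiff {f : ℝ → ℝ → ℝ}
    (hf : ContDiff ℝ (⊤ : ℕ∞) (Function.uncurry f)) (θ t : ℝ) :
    HasDerivAt (f θ) (fderiv ℝ (Function.uncurry f) (θ, t) (0, 1)) t :=
  ((hf.differentiable (by simp)) (θ, t)).hasFDerivAt.comp_hasDerivAt (f := fun s => (θ, s)) t
    ((hasDerivAt_const t θ).prodMk (hasDerivAt_id t))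

theorem hasDerivAt_pd {f : ℝ → ℝ → ℝ}
    (hf : ContDiff ℝ (⊤ : ℕ∞) (Function.uncurry f)) (θ t : ℝ) : HasDerivAt (fun x => f x t) (pd f θ t) θ :=
  (hasDerivAt_fst_of_contDiff hf θ t).differentiableAt.hasDerivAt

theorem hasDerivAt_pt {f : ℝ → ℝ → ℝ}
    (hf : ContDiff ℝ (⊤ : ℕ∞) (Function.uncurry f)) (θ t : ℝ) : HasDerivAt (f θ) (pt f θ t) t :=
  (hasDerivAt_snd_of_contDiff hf θ t).differentiableAt.hasDerivAt

theorem contDiff_pd {f : ℝ → ℝ → ℝ}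
    (hf : ContDiff ℝ (⊤ : ℕ∞) (Function.uncurry f)) :
    ContDiff ℝ (⊤ : ℕ∞) (Function.uncurry (pd f)) := by
  have h : Function.uncurry (pd f) = fun z => fderiv ℝ (Function.uncurry f) z (1, 0) :=
    funext fun z => (hasDerivAt_fst_of_contDiff hf z.1 z.2).deriv
  rw [h]
  exact (hf.fderiv_right (by simp)).clm_apply contDiff_const

theorem contDiff_pt {f : ℝ → ℝ → ℝ}
    (hf : ContDiff ℝ (⊤ : ℕ∞) (Function.uncurry f)) :
    ContDiff ℝ (⊤ : ℕ∞) (Function.uncurry (pt f)) := by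
  have h : Function.uncurry (pt f) = fun z => fderiv ℝ (Function.uncurry f) z (0, 1) :=
    funext fun z => (hasDerivAt_snd_of_contDiff hf z.1 z.2).deriv
  rw [h]
  exact (hf.fderiv_right (by simp)).clm_apply contDiff_const

/-- Time derivative of `∫ (h / k) w` over a segment on which `k` does not vanish. -/
theorem hasDerivAt_integral_div_mul {h k : ℝ → ℝ → ℝ} {w : ℝ → ℝ} {b c t : ℝ}
    (hh : ContDiff ℝ (⊤ : ℕ∞) (Function.uncurry h))
    (hk : ContDiff ℝ (⊤ : ℕ∞) (Function.uncurry k)) (hw : Continuous w)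
    (hk0 : ∀ σ, k σ t ≠ 0) :
    HasDerivAt (fun s => ∫ σ in b..c, h σ s / k σ s * w σ)
      (∫ σ in b..c, (pt h σ t * k σ t - h σ t * pt k σ t) / k σ t ^ 2 * w σ) t := by
  have hhc := hh.continuous
  have hkc := hk.continuous
  have hhtc := (contDiff_pt hh).continuous
  have hktc := (contDiff_pt hk).continuous
  have hwc : Continuous fun z : ℝ × ℝ => w z.1 := hw.comp continuous_fst
  refine hasDerivAt_intervalIntegral_of_continuousOn
    (f := fun σ s => h σ s / k σ s * w σ)
    (f' := fun σ s => (pt h σ s * k σ s - h σ s * pt k σ s) / k σ s ^ 2 * w σ)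
    (U := {z | Function.uncurry k z ≠ 0})
    (isOpen_ne_fun hkc continuous_const) ?_ ?_ ?_ ?_
  · rintro ⟨σ, s⟩ ⟨-, rfl⟩
    exact hk0 σ
  · exact (hhc.continuousOn.div hkc.continuousOn fun z hz => hz).mul hwc.continuousOn
  · exact (((hhtc.mul hkc).sub (hhc.mul hktc)).continuousOn.div (hkc.pow 2).continuousOn
      fun z hz => pow_ne_zero 2 hz).mul hwc.continuousOn
  · intro σ s hs
    exact ((hasDerivAt_pt hh σ s).div (hasDerivAt_pt hk σ s) hs).mul_const (w σ)

theorem stmt7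
    (T : ℝ) (hT : 0 < T)
    (a : ℝ → ℝ → ℝ) (ha : ContDiff ℝ (⊤ : ℕ∞) (Function.uncurry a))
    (haper : ∀ θ t, a (θ + π) t = a θ t)
    (hapos : ∀ θ t, t ∈ Set.Ico 0 T → 0 < a θ t)
    (haapos : ∀ θ t, t ∈ Set.Ico 0 T → 0 < a θ t + pd (pd a) θ t)
    (T₀ : ℝ) (hT₀ : 0 < T₀) (hT₀T : T₀ ≤ T)
    (k : ℝ → ℝ → ℝ) (hksm : ContDiff ℝ (⊤ : ℕ∞) (Function.uncurry k))
    (hkper : ∀ θ t, k (θ + 2 * π) t = k θ t)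
    (hkpos : ∀ θ t, t ∈ Set.Ico 0 T₀ → 0 < k θ t)
    (hkevol : ∀ θ t, t ∈ Set.Ico 0 T₀ →
      pt k θ t =
        a θ t / (a θ t + pd (pd a) θ t) * (k θ t) ^ 2 * pd (pd k) θ t
          + 2 * pd a θ t / (a θ t + pd (pd a) θ t) * (k θ t) ^ 2 * pd k θ t
          + (k θ t) ^ 3
          + pt (fun x s => Real.log (a x s + pd (pd a) x s)) θ t * k θ t)
    (p q : ℝ → ℝ → ℝ × ℝ)
    (hp : ∀ θ t, p θ t = a θ t • er θ + pd a θ t • etheta θ)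
    (hq : ∀ θ t, q θ t = (a θ t)⁻¹ • etheta θ)
    (F : ℝ → ℝ → ℝ × ℝ)
    (hF : ∀ θ t, F θ t =
      (-(∫ σ in (0:ℝ)..θ, (a σ t + pd (pd a) σ t) / k σ t * Real.sin σ)
          - ∫ s in (0:ℝ)..t, a 0 s * k 0 s,
        (∫ σ in (0:ℝ)..θ, (a σ t + pd (pd a) σ t) / k σ t * Real.cos σ)
          - ∫ s in (0:ℝ)..t, (a 0 s * pd k 0 s + pd a 0 s * k 0 s)))
    :
    ∀ θ t, t ∈ Set.Ico 0 T₀ →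
      ptv F θ t = (-(k θ t)) • p θ t - (a θ t ^ 2 * pd k θ t) • q θ t := by
  intro θ t ht
  have hka : ∀ σ, k σ t ≠ 0 := fun σ => (hkpos σ t ht).ne'
  have htT : t ∈ Set.Ico 0 T := ⟨ht.1, ht.2.trans_le hT₀T⟩
  have ha' := contDiff_pd ha
  have hk' := contDiff_pd hksm
  set h : ℝ → ℝ → ℝ := fun σ s => a σ s + pd (pd a) σ s with h_def
  have hh : ContDiff ℝ (⊤ : ℕ∞) (Function.uncurry h) := ha.add (contDiff_pd ha')
  have hh0 : ∀ σ, h σ t ≠ 0 := fun σ => (haapos σ t htT).ne'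
  have hquot : ∀ σ, (pt h σ t * k σ t - h σ t * pt k σ t) / k σ t ^ 2 =
      -(a σ t * pd (pd k) σ t + 2 * pd a σ t * pd k σ t + h σ t * k σ t) := by
    intro σ
    have hlog : pt (fun x s => Real.log (h x s)) σ t = pt h σ t / h σ t :=
      ((hasDerivAt_pt hh σ t).log (hh0 σ)).deriv
    have hev : pt k σ t = a σ t / h σ t * (k σ t) ^ 2 * pd (pd k) σ t
        + 2 * pd a σ t / h σ t * (k σ t) ^ 2 * pd k σ t + (k σ t) ^ 3
        + pt h σ t / h σ t * k σ t := hlog ▸ hkevol σ t ht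
    have := hka σ
    have := hh0 σ
    rw [hev]
    field_simp
    ring
  have hcont : ∀ {f : ℝ → ℝ → ℝ}, ContDiff ℝ (⊤ : ℕ∞) (Function.uncurry f) →
      Continuous fun σ => f σ t := fun hf =>
    hf.continuous.comp (f := fun σ => (σ, t)) (by fun_prop)
  have hac := hcont ha
  have hkc := hcont hksm
  have hac' := hcont ha'
  have hkc' := hcont hk'
  have hkc'' := hcont (contDiff_pd hk')
  have hhc := hcont hh
  have hak (σ : ℝ) := (hasDerivAt_pd ha σ t).mul (hasDerivAt_pd hksm σ t)
  have hak' (σ : ℝ) := ((hasDerivAt_pd ha' σ t).mul (hasDerivAt_pd hksm σ t)).add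
    ((hasDerivAt_pd ha σ t).mul (hasDerivAt_pd hk' σ t))
  have hsin : ∫ σ in (0:ℝ)..θ,
        (pt h σ t * k σ t - h σ t * pt k σ t) / k σ t ^ 2 * Real.sin σ =
      a θ t * k θ t * Real.cos θ - (pd a θ t * k θ t + a θ t * pd k θ t) * Real.sin θ
        - a 0 t * k 0 t := by
    simp only [hquot]
    rw [intervalIntegral.integral_eq_sub_of_hasDerivAt
      (f := fun σ => a σ t * k σ t * Real.cos σ
        - (pd a σ t * k σ t + a σ t * pd k σ t) * Real.sin σ) (fun σ _ => ?_)
      (Continuous.intervalIntegrable (by fun_prop) _ _)]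
    · simp
    · refine (((hak σ).mul (Real.hasDerivAt_cos σ)).sub
        ((hak' σ).mul (Real.hasDerivAt_sin σ))).congr_deriv ?_
      simp only [h_def, Pi.mul_apply, Pi.add_apply]
      ring
  have hcos : ∫ σ in (0:ℝ)..θ,
        (pt h σ t * k σ t - h σ t * pt k σ t) / k σ t ^ 2 * Real.cos σ =
      -(a θ t * k θ t * Real.sin θ) - (pd a θ t * k θ t + a θ t * pd k θ t) * Real.cos θ
        + (a 0 t * pd k 0 t + pd a 0 t * k 0 t) := by
    simp only [hquot]
    rw [intervalIntegral.integral_eq_sub_of_hasDerivAt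
      (f := fun σ => -(a σ t * k σ t * Real.sin σ)
        - (pd a σ t * k σ t + a σ t * pd k σ t) * Real.cos σ) (fun σ _ => ?_)
      (Continuous.intervalIntegrable (by fun_prop) _ _)]
    · simp only [Real.sin_zero, Real.cos_zero]
      ring
    · refine (((hak σ).mul (Real.hasDerivAt_sin σ)).neg.sub
        ((hak' σ).mul (Real.hasDerivAt_cos σ))).congr_deriv ?_
      simp only [h_def, Pi.mul_apply, Pi.add_apply]
      ring
  have hslice : ∀ {f : ℝ → ℝ → ℝ}, ContDiff ℝ (⊤ : ℕ∞) (Function.uncurry f) →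
      Continuous (f 0) := fun hf =>
    hf.continuous.comp (f := fun s => ((0 : ℝ), s)) (by fun_prop)
  have hF₁ := (hasDerivAt_integral_div_mul (b := 0) (c := θ) hh hksm Real.continuous_sin hka).neg.sub
    (((hslice ha).mul (hslice hksm)).integral_hasStrictDerivAt 0 t).hasDerivAt
  have hF₂ := (hasDerivAt_integral_div_mul (b := 0) (c := θ) hh hksm Real.continuous_cos hka).sub
    ((((hslice ha).mul (hslice hk')).add
      ((hslice ha').mul (hslice hksm))).integral_hasStrictDerivAt 0 t).hasDerivAt
  have hFt : ptv F θ t = _ :=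
    ((hF₁.prodMk hF₂).congr_of_eventuallyEq (.of_forall fun s => hF θ s)).deriv
  have ha0 : a θ t ≠ 0 := (hapos θ t htT).ne'
  rw [hFt, hsin, hcos, hp, hq]
  ext
  · simp [er, etheta]
    field_simp
    ring
  · simp [er, etheta]
    field_simp
    ring
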